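/- Let f : U → ℝ³ with unit normal ν be a frontal in orthogonal adapted coordinates (u,v) around a pure-frontal singular point at the origin (Ñ(u,0) = 0 for all u), assume the origin is not an umbilic point (((1/3)·r_b(0) − κ_ν(0))² + 4·κ_t(0)² ≠ 0), and assume the cuspidal torsion vanishes identically along the singular curve: κ_t(u) = 0 for all u. Let V_j = (−v·(M̃ − κ_j·F̃))·∂_u + (L̃ − κ_j·Ẽ)·∂_v (j = 1,2) be the smoothly extended principal vector fields. Then there exist smooth vector fields W₁, W₂ on a neighborhood W of the origin such that W₁(0,0) and W₂(0,0) are linearly independent and, for each q ∈ W and each j ∈ {1,2}, V_j(q) and W_j(q) are linearly dependent. -/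

import Mathlib

noncomputable section

open Matrix Set
open scoped ContDiff

abbrev V3 : Type := Fin 3 → ℝ

/-- Partial derivative in the `u`-direction. -/
def Du {E : Type*} [NormedAddCommGroup E] [NormedSpace ℝ E] (g : ℝ × ℝ → E) (p : ℝ × ℝ) : E :=
  fderiv ℝ g p (1, 0)

/-- Partial derivative in the `v`-direction. -/
def Dv {E : Type*} [NormedAddCommGroup E] [NormedSpace ℝ E] (g : ℝ × ℝ → E) (p : ℝ × ℝ) : E :=
  fderiv ℝ g p (0, 1)

def det3 (a b c : V3) : ℝ := Matrix.det (Matrix.of ![a, b, c])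

def dot (x y : V3) : ℝ := x ⬝ᵥ y

def nrm (x : V3) : ℝ := Real.sqrt (dot x x)

def cross3 (x y : V3) : V3 := crossProduct x y

structure FrontalData where
  f : ℝ × ℝ → V3
  nu : ℝ × ℝ → V3
  h : ℝ × ℝ → V3

namespace FrontalData

def Et (X : FrontalData) (p : ℝ × ℝ) : ℝ := dot (Du X.f p) (Du X.f p)
def Ft (X : FrontalData) (p : ℝ × ℝ) : ℝ := dot (Du X.f p) (X.h p)
def Gt (X : FrontalData) (p : ℝ × ℝ) : ℝ := dot (X.h p) (X.h p)
def Lt (X : FrontalData) (p : ℝ × ℝ) : ℝ := -(dot (Du X.f p) (Du X.nu p))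
def Mt (X : FrontalData) (p : ℝ × ℝ) : ℝ := -(dot (X.h p) (Du X.nu p))
def Nt (X : FrontalData) (p : ℝ × ℝ) : ℝ := -(dot (X.h p) (Dv X.nu p))

def EGF (X : FrontalData) (p : ℝ × ℝ) : ℝ := X.Et p * X.Gt p - (X.Ft p) ^ 2

/-- `f` is a frontal with unit normal `nu`, in adapted coordinates around a singular point of
the first kind at the origin: `f_v = v • h` and `{f_u, h, nu}` is a frame. -/
def IsAdapted (X : FrontalData) (U : Set (ℝ × ℝ)) : Prop :=
  IsOpen U ∧ (0, 0) ∈ U ∧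
  ContDiff ℝ ∞ X.f ∧ ContDiff ℝ ∞ X.nu ∧ ContDiff ℝ ∞ X.h ∧
  (∀ p ∈ U, dot (X.nu p) (X.nu p) = 1) ∧
  (∀ p ∈ U, dot (Du X.f p) (X.nu p) = 0) ∧
  (∀ p ∈ U, dot (Dv X.f p) (X.nu p) = 0) ∧
  (∀ p ∈ U, Dv X.f p = p.2 • X.h p) ∧
  (∀ p ∈ U, det3 (Du X.f p) (X.h p) (X.nu p) ≠ 0) ∧
  (∀ p ∈ U, 0 < X.EGF p)

/-- orthogonal adapted coordinates -/
def IsOrthogonal (X : FrontalData) (U : Set (ℝ × ℝ)) : Prop :=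
  ∀ u : ℝ, (u, 0) ∈ U → X.Et (u, 0) = 1 ∧ X.Gt (u, 0) = 1 ∧ X.Ft (u, 0) = 0

/-- Gaussian curvature on `{v ≠ 0}`. -/
def Kdef (X : FrontalData) (p : ℝ × ℝ) : ℝ :=
  (X.Lt p * X.Nt p - p.2 * (X.Mt p) ^ 2) / (p.2 * X.EGF p)

/-- Mean curvature on `{v ≠ 0}`. -/
def Hdef (X : FrontalData) (p : ℝ × ℝ) : ℝ :=
  (X.Et p * X.Nt p - 2 * p.2 * X.Ft p * X.Mt p + p.2 * X.Gt p * X.Lt p) / (2 * p.2 * X.EGF p)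

/-- Principal curvatures on `{v ≠ 0}`. -/
def kap1 (X : FrontalData) (p : ℝ × ℝ) : ℝ := X.Hdef p + Real.sqrt ((X.Hdef p) ^ 2 - X.Kdef p)
def kap2 (X : FrontalData) (p : ℝ × ℝ) : ℝ := X.Hdef p - Real.sqrt ((X.Hdef p) ^ 2 - X.Kdef p)

/-- Limiting normal curvature along the singular curve. -/
def kapNu (X : FrontalData) (u : ℝ) : ℝ := X.Lt (u, 0)
/-- Cuspidal torsion along the singular curve. -/
def kapT (X : FrontalData) (u : ℝ) : ℝ := X.Mt (u, 0)
/-- Bias along the singular curve. -/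
def rb (X : FrontalData) (u : ℝ) : ℝ := 3 * Dv X.Nt (u, 0)
/-- Secondary cuspidal curvature along the singular curve. -/
def rc (X : FrontalData) (u : ℝ) : ℝ :=
  12 * (Dv (Dv X.Nt) (u, 0) - 4 * Dv X.Ft (u, 0) * X.Mt (u, 0) -
    2 * Dv X.Gt (u, 0) * Dv X.Nt (u, 0))

end FrontalData

/-- Directional derivative of a map along the vector field `a ∂_u + ∂_v`. -/
def etaD (a : ℝ × ℝ → ℝ) (g : ℝ × ℝ → V3) : ℝ × ℝ → V3 :=
  fun p => a p • Du g p + Dv g p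

open intervalIntegral Filter Topology in
lemma hasFDerivAt_intervalIntegral_of_contDiff_one {E F : Type} [NormedAddCommGroup E]
    [NormedSpace ℝ E] [ProperSpace E] [NormedAddCommGroup F] [NormedSpace ℝ F]
    {g : E × ℝ → F} (hg : ContDiff ℝ 1 g) (x₀ : E) :
    HasFDerivAt (fun x => ∫ t in (0 : ℝ)..1, g (x, t))
      (∫ t in (0 : ℝ)..1, (fderiv ℝ g (x₀, t)).comp (ContinuousLinearMap.inl ℝ E ℝ)) x₀ := by
  have hcont : Continuous fun p : E × ℝ =>
      (fderiv ℝ g p).comp (ContinuousLinearMap.inl ℝ E ℝ) :=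
    (hg.continuous_fderiv one_ne_zero).clm_comp continuous_const
  obtain ⟨C, hC⟩ := ((isCompact_closedBall x₀ 1).prod
    (isCompact_Icc (a := (0 : ℝ)) (b := 1))).exists_bound_of_continuousOn hcont.continuousOn
  refine hasFDerivAt_integral_of_dominated_of_fderiv_le (bound := fun _ => C)
    (F := fun x t => g (x, t))
    (F' := fun x t => (fderiv ℝ g (x, t)).comp (ContinuousLinearMap.inl ℝ E ℝ))
    (Metric.closedBall_mem_nhds x₀ one_pos) ?_ ?_ ?_ ?_ ?_ ?_
  · exact Eventually.of_forall fun x =>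
      (hg.continuous.comp (by fun_prop : Continuous fun t : ℝ => (x, t))).aestronglyMeasurable
  · exact (hg.continuous.comp
      (by fun_prop : Continuous fun t : ℝ => (x₀, t))).intervalIntegrable _ _
  · exact (hcont.comp (by fun_prop : Continuous fun t : ℝ => (x₀, t))).aestronglyMeasurable
  · refine Eventually.of_forall fun t ht x hx => hC (x, t) ⟨hx, ?_⟩
    rw [uIoc_of_le zero_le_one] at ht
    exact ⟨ht.1.le, ht.2⟩
  · exact intervalIntegrable_const
  · refine Eventually.of_forall fun t _ x _ => ?_
    exact ((hg.differentiable one_ne_zero) (x, t)).hasFDerivAt.comp x (hasFDerivAt_prodMk_left x t)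

lemma ContDiff.intervalIntegral_param_nat {E : Type} [NormedAddCommGroup E]
    [NormedSpace ℝ E] [ProperSpace E] (n : ℕ) {F : Type} [NormedAddCommGroup F] [NormedSpace ℝ F]
    {g : E × ℝ → F} (hg : ContDiff ℝ ∞ g) :
    ContDiff ℝ n fun x => ∫ t in (0 : ℝ)..1, g (x, t) := by
  induction n generalizing F with
  | zero =>
    refine contDiff_zero.2 ?_
    exact intervalIntegral.continuous_parametric_intervalIntegral_of_continuous'
      (f := fun x t => g (x, t)) hg.continuous 0 1
  | succ n ih =>
    have hd := hasFDerivAt_intervalIntegral_of_contDiff_one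
      (hg.of_le (by exact_mod_cast le_top : (1 : WithTop ℕ∞) ≤ ∞))
    push_cast
    refine contDiff_succ_iff_fderiv.2 ⟨fun x => (hd x).differentiableAt, by simp, ?_⟩
    rw [funext fun x => (hd x).fderiv]
    exact ih (g := fun p => (fderiv ℝ g p).comp (ContinuousLinearMap.inl ℝ E ℝ))
      ((hg.fderiv_right (by simp)).clm_comp contDiff_const)

lemma ContDiff.intervalIntegral_param {E F : Type} [NormedAddCommGroup E]
    [NormedSpace ℝ E] [ProperSpace E] [NormedAddCommGroup F] [NormedSpace ℝ F]
    {g : E × ℝ → F} (hg : ContDiff ℝ ∞ g) :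
    ContDiff ℝ ∞ fun x => ∫ t in (0 : ℝ)..1, g (x, t) :=
  contDiff_infty.2 fun n => ContDiff.intervalIntegral_param_nat n hg

lemma ContDiff.Du {E : Type*} [NormedAddCommGroup E] [NormedSpace ℝ E] {g : ℝ × ℝ → E}
    (hg : ContDiff ℝ ∞ g) : ContDiff ℝ ∞ (Du g) :=
  (hg.fderiv_right (by simp)).clm_apply contDiff_const

lemma ContDiff.Dv {E : Type*} [NormedAddCommGroup E] [NormedSpace ℝ E] {g : ℝ × ℝ → E}
    (hg : ContDiff ℝ ∞ g) : ContDiff ℝ ∞ (Dv g) :=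
  (hg.fderiv_right (by simp)).clm_apply contDiff_const

lemma ContDiff.dot {a b : ℝ × ℝ → V3} (ha : ContDiff ℝ ∞ a) (hb : ContDiff ℝ ∞ b) :
    ContDiff ℝ ∞ fun p => dot (a p) (b p) := by
  simp only [_root_.dot, dotProduct]
  exact ContDiff.sum fun i _ => (contDiff_pi.1 ha i).mul (contDiff_pi.1 hb i)

/-- Hadamard's lemma in the second variable. -/
lemma exists_contDiff_eq_add_mul {g : ℝ × ℝ → ℝ} (hg : ContDiff ℝ ∞ g) :
    ∃ m : ℝ × ℝ → ℝ, ContDiff ℝ ∞ m ∧ (∀ u v, g (u, v) = g (u, 0) + v * m (u, v)) ∧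
      ∀ u, m (u, 0) = Dv g (u, 0) := by
  have hcomp : ContDiff ℝ ∞ fun q : (ℝ × ℝ) × ℝ => Dv g (q.1.1, q.2 * q.1.2) :=
    hg.Dv.comp (by fun_prop)
  refine ⟨fun p => ∫ t in (0 : ℝ)..1, Dv g (p.1, t * p.2), hcomp.intervalIntegral_param,
    fun u v => ?_, fun u => by simp⟩
  have hderiv : ∀ t : ℝ, HasDerivAt (fun s : ℝ => g (u, s * v)) (v * Dv g (u, t * v)) t := by
    intro t
    have hline : HasDerivAt (fun s : ℝ => ((u, s * v) : ℝ × ℝ)) (0, v) t :=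
      (hasDerivAt_const t u).prodMk (by simpa using (hasDerivAt_id t).mul_const v)
    have hgd := ((hg.differentiable (by simp)) (u, t * v)).hasFDerivAt.comp_hasDerivAt t hline
    have hsmul : ((0, v) : ℝ × ℝ) = v • (0, 1) := by simp
    rwa [hsmul, map_smul, smul_eq_mul] at hgd
  have hcont : Continuous fun t : ℝ => v * Dv g (u, t * v) :=
    continuous_const.mul (hg.Dv.continuous.comp (by fun_prop))
  have hftc := intervalIntegral.integral_eq_sub_of_hasDerivAt (a := 0) (b := 1)
    (fun t _ => hderiv t) (hcont.intervalIntegrable _ _)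
  rw [intervalIntegral.integral_const_mul] at hftc
  simp only [one_mul, zero_mul] at hftc
  linarith

open Filter Topology in
lemma eq_zero_of_eq_zero_off_axis {W : Set (ℝ × ℝ)} (hW : IsOpen W) {P : ℝ × ℝ → ℝ}
    (hP : ContinuousOn P W) (h0 : ∀ p ∈ W, p.2 ≠ 0 → P p = 0) : ∀ p ∈ W, P p = 0 := by
  rintro ⟨u, v⟩ hp
  by_cases hv : v = 0
  swap
  · exact h0 _ hp hv
  subst hv
  have hline : Tendsto (fun t : ℝ => ((u, t) : ℝ × ℝ)) (𝓝[≠] 0) (𝓝 (u, 0)) :=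
    ((by fun_prop : Continuous fun t : ℝ => ((u, t) : ℝ × ℝ)).tendsto 0).mono_left
      nhdsWithin_le_nhds
  have hlim := ((hP.continuousAt (hW.mem_nhds hp)).tendsto).comp hline
  refine tendsto_nhds_unique hlim (tendsto_const_nhds.congr' ?_)
  filter_upwards [hline (hW.mem_nhds hp), self_mem_nhdsWithin] with t ht ht0
  exact (h0 _ ht ht0).symm

/-- The discriminant of the characteristic polynomial of a symmetric form with respect to a
definite one is nonnegative. -/
lemma discrim_nonneg_of_definite {E F G L M N : ℝ} (hD : 0 < E * G - F ^ 2) :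
    0 ≤ ((E * N - 2 * F * M + G * L) / (2 * (E * G - F ^ 2))) ^ 2 -
      (L * N - M ^ 2) / (E * G - F ^ 2) := by
  have hE : E ≠ 0 := by
    rintro rfl
    nlinarith [sq_nonneg F]
  have key : ((E * N - 2 * F * M + G * L) / (2 * (E * G - F ^ 2))) ^ 2 -
      (L * N - M ^ 2) / (E * G - F ^ 2) =
      (4 * (E * G - F ^ 2) * ((E * M - F * L) / E) ^ 2 +
        (E * N - G * L - 2 * F / E * (E * M - F * L)) ^ 2) / (2 * (E * G - F ^ 2)) ^ 2 := by
    have := hD.ne'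
    field_simp
    ring
  rw [key]
  positivity

namespace FrontalData

lemma kap1_add_kap2 (X : FrontalData) {p : ℝ × ℝ} {n : ℝ} (hv : p.2 ≠ 0) (hD : 0 < X.EGF p)
    (hN : X.Nt p = p.2 * n) :
    X.EGF p * (X.kap1 p + X.kap2 p) = X.Et p * n - 2 * X.Ft p * X.Mt p + X.Gt p * X.Lt p := by
  simp only [kap1, kap2, Hdef, hN]
  have := hD.ne'
  field_simp
  ring

lemma characteristic_eq (X : FrontalData) {p : ℝ × ℝ} {n : ℝ} (hv : p.2 ≠ 0)
    (hD : 0 < X.EGF p) (hN : X.Nt p = p.2 * n) {k : ℝ} (hk : k = X.kap1 p ∨ k = X.kap2 p) :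
    (X.Mt p - k * X.Ft p) ^ 2 = (X.Lt p - k * X.Et p) * (n - k * X.Gt p) := by
  have hDne := hD.ne'
  have hH : X.Hdef p = (X.Et p * n - 2 * X.Ft p * X.Mt p + X.Gt p * X.Lt p) / (2 * X.EGF p) := by
    simp only [Hdef, hN]
    field_simp
  have hK : X.Kdef p = (X.Lt p * n - X.Mt p ^ 2) / X.EGF p := by
    simp only [Kdef, hN]
    field_simp
  have hdisc : 0 ≤ X.Hdef p ^ 2 - X.Kdef p := by
    rw [hH, hK]
    exact discrim_nonneg_of_definite hD
  have hquad : k ^ 2 - 2 * X.Hdef p * k + X.Kdef p = 0 := by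
    have hsq := Real.sq_sqrt hdisc
    rcases hk with rfl | rfl
    · simp only [kap1]
      linear_combination hsq
    · simp only [kap2]
      linear_combination hsq
  have hH' : 2 * X.EGF p * X.Hdef p = X.Et p * n - 2 * X.Ft p * X.Mt p + X.Gt p * X.Lt p := by
    rw [hH]
    field_simp
  have hK' : X.EGF p * X.Kdef p = X.Lt p * n - X.Mt p ^ 2 := by
    rw [hK]
    field_simp
  have hDdef : X.EGF p = X.Et p * X.Gt p - X.Ft p ^ 2 := rfl
  linear_combination (-X.EGF p) * hquad - k * hH' + hK' + k ^ 2 * hDdef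

end FrontalData

/-- near a non-umbilic pure-frontal singular point with vanishing cuspidal
torsion along the singular curve, there are smooth vector fields `W₁, W₂`, linearly
independent at the origin, with `V_j ∥ W_j` pointwise. -/
theorem stmt9 (X : FrontalData) (U : Set (ℝ × ℝ))
    (hA : X.IsAdapted U) (hO : X.IsOrthogonal U)
    (hpure : ∀ u : ℝ, (u, 0) ∈ U → X.Nt (u, 0) = 0)
    (humb : ((1 / 3) * X.rb 0 - X.kapNu 0) ^ 2 + 4 * (X.kapT 0) ^ 2 ≠ 0)
    (hkt : ∀ u : ℝ, (u, 0) ∈ U → X.kapT u = 0)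
    (k1 k2 : ℝ × ℝ → ℝ)
    (hk1 : ContDiffOn ℝ ∞ k1 U) (hk2 : ContDiffOn ℝ ∞ k2 U)
    (hk1e : ∀ p ∈ U, p.2 ≠ 0 → k1 p = X.kap1 p)
    (hk2e : ∀ p ∈ U, p.2 ≠ 0 → k2 p = X.kap2 p) :
    ∃ W : Set (ℝ × ℝ), IsOpen W ∧ (0, 0) ∈ W ∧ W ⊆ U ∧
      ∃ W1 W2 : ℝ × ℝ → ℝ × ℝ, ContDiffOn ℝ ∞ W1 W ∧ ContDiffOn ℝ ∞ W2 W ∧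
        (W1 (0, 0)).1 * (W2 (0, 0)).2 - (W1 (0, 0)).2 * (W2 (0, 0)).1 ≠ 0 ∧
        ∀ q ∈ W,
          (-(q.2) * (X.Mt q - k1 q * X.Ft q)) * (W1 q).2 -
              (X.Lt q - k1 q * X.Et q) * (W1 q).1 = 0 ∧
          (-(q.2) * (X.Mt q - k2 q * X.Ft q)) * (W2 q).2 -
              (X.Lt q - k2 q * X.Et q) * (W2 q).1 = 0 := by
  obtain ⟨hUo, h0U, hf, hnu, hh, -, -, -, -, -, hD⟩ := hA
  have hEt : ContDiff ℝ ∞ X.Et := hf.Du.dot hf.Du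
  have hFt : ContDiff ℝ ∞ X.Ft := hf.Du.dot hh
  have hGt : ContDiff ℝ ∞ X.Gt := hh.dot hh
  have hLt : ContDiff ℝ ∞ X.Lt := (hf.Du.dot hnu.Du).neg
  have hMt : ContDiff ℝ ∞ X.Mt := (hh.dot hnu.Du).neg
  have hNt : ContDiff ℝ ∞ X.Nt := (hh.dot hnu.Dv).neg
  obtain ⟨m, hm, hMm, -⟩ := exists_contDiff_eq_add_mul hMt
  obtain ⟨φ, hφ, hFφ, -⟩ := exists_contDiff_eq_add_mul hFt
  obtain ⟨n, hn, hNn, hn0⟩ := exists_contDiff_eq_add_mul hNt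
  obtain ⟨W, hWdef⟩ : ∃ W, W = U ∩ (fun p : ℝ × ℝ => ((p.1, 0) : ℝ × ℝ)) ⁻¹' U := ⟨_, rfl⟩
  have hWo : IsOpen W := hWdef ▸ hUo.inter (hUo.preimage (by fun_prop))
  have hWU : W ⊆ U := hWdef ▸ inter_subset_left
  have h0W : ((0, 0) : ℝ × ℝ) ∈ W := hWdef ▸ ⟨h0U, h0U⟩
  have hWaxis : ∀ p ∈ W, ((p.1, 0) : ℝ × ℝ) ∈ U := fun p hp => by
    rw [hWdef] at hp
    exact hp.2
  have hM : ∀ p ∈ W, X.Mt p = p.2 * m p := fun p hp => by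
    have h0 : X.Mt (p.1, 0) = 0 := hkt _ (hWaxis p hp)
    simpa [h0] using hMm p.1 p.2
  have hF : ∀ p ∈ W, X.Ft p = p.2 * φ p := fun p hp => by
    simpa [(hO _ (hWaxis p hp)).2.2] using hFφ p.1 p.2
  have hN : ∀ p ∈ W, X.Nt p = p.2 * n p := fun p hp => by
    simpa [hpure _ (hWaxis p hp)] using hNn p.1 p.2
  have hk1W := hk1.mono hWU
  have hk2W := hk2.mono hWU
  have hchar : ∀ k : ℝ × ℝ → ℝ, ContDiffOn ℝ ∞ k W →
      (∀ p ∈ W, p.2 ≠ 0 → k p = X.kap1 p ∨ k p = X.kap2 p) →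
      ∀ p ∈ W, (X.Mt p - k p * X.Ft p) ^ 2 -
        (X.Lt p - k p * X.Et p) * (n p - k p * X.Gt p) = 0 := by
    intro k hk hke
    refine eq_zero_of_eq_zero_off_axis hWo ?_ fun p hp hv =>
      sub_eq_zero.2 (X.characteristic_eq hv (hD p (hWU hp)) (hN p hp) (hke p hp hv))
    have hkc := hk.continuousOn
    have := hMt.continuous
    have := hFt.continuous
    have := hLt.continuous
    have := hEt.continuous
    have := hGt.continuous
    have := hn.continuous
    fun_prop
  have hchar1 := hchar k1 hk1W fun p hp hv => Or.inl (hk1e p (hWU hp) hv)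
  have hchar2 := hchar k2 hk2W fun p hp hv => Or.inr (hk2e p (hWU hp) hv)
  have hsum : ∀ p ∈ W, (X.Et p * X.Gt p - X.Ft p ^ 2) * (k1 p + k2 p) -
      (X.Et p * n p - 2 * X.Ft p * X.Mt p + X.Gt p * X.Lt p) = 0 := by
    refine eq_zero_of_eq_zero_off_axis hWo ?_ fun p hp hv => ?_
    · have hkc1 := hk1W.continuousOn
      have hkc2 := hk2W.continuousOn
      have := hMt.continuous
      have := hFt.continuous
      have := hLt.continuous
      have := hEt.continuous
      have := hGt.continuous
      have := hn.continuous
      fun_prop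
    · rw [hk1e p (hWU hp) hv, hk2e p (hWU hp) hv]
      exact sub_eq_zero.2 (X.kap1_add_kap2 hv (hD p (hWU hp)) (hN p hp))
  obtain ⟨hE0, hG0, hF0⟩ := hO 0 h0U
  have hM0 : X.Mt (0, 0) = 0 := hkt 0 h0U
  have hnL : n (0, 0) ≠ X.Lt (0, 0) := by
    intro heq
    apply humb
    have hT : X.kapT 0 = 0 := hkt 0 h0U
    rw [hT, FrontalData.rb, FrontalData.kapNu, ← hn0, heq]
    ring
  have hroot := hchar1 _ h0W
  have hsum0 := hsum _ h0W
  simp only [hE0, hG0, hF0, hM0] at hroot hsum0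
  -- The two proportional rows of the eigenvector equation.
  obtain ⟨A, hA⟩ : ∃ A : (ℝ × ℝ → ℝ) → ℝ × ℝ → ℝ × ℝ, A = fun k p =>
      (-(p.2) * (X.Mt p - k p * X.Ft p), X.Lt p - k p * X.Et p) := ⟨_, rfl⟩
  obtain ⟨B, hB⟩ : ∃ B : (ℝ × ℝ → ℝ) → ℝ × ℝ → ℝ × ℝ, B = fun k p =>
      (n p - k p * X.Gt p, -(m p - k p * φ p)) := ⟨_, rfl⟩
  have hAs : ∀ k, ContDiffOn ℝ ∞ k W → ContDiffOn ℝ ∞ (A k) W := by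
    intro k hk
    rw [hA]
    fun_prop
  have hBs : ∀ k, ContDiffOn ℝ ∞ k W → ContDiffOn ℝ ∞ (B k) W := by
    intro k hk
    rw [hB]
    fun_prop
  have hApar : ∀ k : ℝ × ℝ → ℝ, ∀ q, (-(q.2) * (X.Mt q - k q * X.Ft q)) * (A k q).2 -
      (X.Lt q - k q * X.Et q) * (A k q).1 = 0 := by
    intro k q
    rw [hA]
    ring
  have hBpar : ∀ k : ℝ × ℝ → ℝ, ∀ q ∈ W, (X.Mt q - k q * X.Ft q) ^ 2 -
      (X.Lt q - k q * X.Et q) * (n q - k q * X.Gt q) = 0 →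
      (-(q.2) * (X.Mt q - k q * X.Ft q)) * (B k q).2 -
      (X.Lt q - k q * X.Et q) * (B k q).1 = 0 := by
    intro k q hq hc
    rw [hB]
    rw [hM q hq, hF q hq] at hc ⊢
    linear_combination hc
  refine ⟨W, hWo, h0W, hWU, ?_⟩
  have hcases : k1 (0, 0) = X.Lt (0, 0) ∨ k1 (0, 0) = n (0, 0) := by
    have hprod : (k1 (0, 0) - X.Lt (0, 0)) * (k1 (0, 0) - n (0, 0)) = 0 := by
      linear_combination -hroot
    rcases mul_eq_zero.1 hprod with h | h
    · exact Or.inl (sub_eq_zero.1 h)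
    · exact Or.inr (sub_eq_zero.1 h)
  rcases hcases with hk | hk
  · have hk' : k2 (0, 0) = n (0, 0) := by linear_combination hsum0 - hk
    refine ⟨B k1, A k2, hBs _ hk1W, hAs _ hk2W, ?_,
      fun q hq => ⟨hBpar k1 q hq (hchar1 q hq), hApar k2 q⟩⟩
    have hval : (n (0, 0) - X.Lt (0, 0)) * (X.Lt (0, 0) - n (0, 0)) ≠ 0 :=
      mul_ne_zero (sub_ne_zero.2 hnL) (sub_ne_zero.2 hnL.symm)
    simpa [hA, hB, hk, hk', hE0, hG0] using hval
  · have hk' : k2 (0, 0) = X.Lt (0, 0) := by linear_combination hsum0 - hk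
    refine ⟨A k1, B k2, hAs _ hk1W, hBs _ hk2W, ?_,
      fun q hq => ⟨hApar k1 q, hBpar k2 q hq (hchar2 q hq)⟩⟩
    have hval : (X.Lt (0, 0) - n (0, 0)) * (n (0, 0) - X.Lt (0, 0)) ≠ 0 :=
      mul_ne_zero (sub_ne_zero.2 hnL.symm) (sub_ne_zero.2 hnL)
    simpa [hA, hB, hk, hk', hE0, hG0] using hval
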